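/- Let N ≥ 3 be an odd integer, κ ∈ (0,1), θ_j = 2πj/N, let ψ_k be the DSM-QR basis functions and G the matrix G_{jk} = ψ_k(1,θ_j). Then for every integer n and all s, θ ∈ ℝ, writing w = s·e^{iθ}: Σ_{k=1}^N ([GᵀG]_{kk})^{−1}·(Σ_{j=1}^N ψ_k(1,θ_j)·e^{inθ_j})·ψ_k(s,θ) equals 1 if n ≡ 0 (mod N); equals (1+κ^{N−2m})^{−1}·(w^m + κ^{N−2m}·conj(w)^{N−m}) if n ≡ m (mod N) for the unique m ∈ {1,…,(N−1)/2}; and equals (1+κ^{N−2m})^{−1}·(conj(w)^m + κ^{N−2m}·w^{N−m}) if n ≡ −m (mod N) for the unique m ∈ {1,…,(N−1)/2}. -/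

import Mathlib

open Matrix

/-- The DSM-QR basis function `ψ_k(s,θ)` (1-based index `k`): `ψ_1(s,θ) = √N` and, for
`m = 1,…,(N−1)/2`, `ψ_{2m}(s,θ) = √(N/2)(s^m sin(mθ) − κ^{N−2m} s^{N−m} sin((N−m)θ))`,
`ψ_{2m+1}(s,θ) = √(N/2)(s^m cos(mθ) + κ^{N−2m} s^{N−m} cos((N−m)θ))`. -/
noncomputable def psi (N : ℕ) (κ : ℝ) (k : ℕ) (s θ : ℝ) : ℝ :=
  if k = 1 then Real.sqrt N
  else if k % 2 = 0 then
    Real.sqrt ((N : ℝ) / 2) *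
      (s ^ (k / 2) * Real.sin ((k / 2 : ℕ) * θ) -
        κ ^ (N - 2 * (k / 2)) * s ^ (N - k / 2) * Real.sin (((N - k / 2 : ℕ) : ℝ) * θ))
  else
    Real.sqrt ((N : ℝ) / 2) *
      (s ^ (k / 2) * Real.cos ((k / 2 : ℕ) * θ) +
        κ ^ (N - 2 * (k / 2)) * s ^ (N - k / 2) * Real.cos (((N - k / 2 : ℕ) : ℝ) * θ))

/-- The collocation angle `θ_j = 2πj/N`. -/
noncomputable def theta (N : ℕ) (j : ℕ) : ℝ := 2 * Real.pi * j / N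

/-- The DSM-QR collocation matrix `G`, with `G_{jk} = ψ_k(1, θ_j)` (1-based `j,k`). -/
noncomputable def Gmat (N : ℕ) (κ : ℝ) : Matrix (Fin N) (Fin N) ℝ := fun j k =>
  psi N κ (k.val + 1) 1 (theta N (j.val + 1))

/-- The function `φ_n^{(N)}(s,θ) = Σ_{k=1}^N ([GᵀG]_{kk})⁻¹ (Σ_{j=1}^N ψ_k(1,θ_j) e^{inθ_j}) ψ_k(s,θ)`. -/
noncomputable def dsmSum (N : ℕ) (κ : ℝ) (n : ℤ) (s θ : ℝ) : ℂ :=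
  ∑ k : Fin N,
    (((((Gmat N κ)ᵀ * Gmat N κ) k k : ℝ) : ℂ))⁻¹ *
      (∑ j : Fin N, (psi N κ (k.val + 1) 1 (theta N (j.val + 1)) : ℂ) *
        Complex.exp (n * theta N (j.val + 1) * Complex.I)) *
      (psi N κ (k.val + 1) s θ : ℂ)

open Complex in
/-- Orthogonality of the characters `e^{iaθ_j}` on the collocation points. -/
theorem sum_exp_theta (N : ℕ) (hN : 0 < N) (a : ℤ) :
    ∑ j : Fin N, exp (a * theta N (j.val + 1) * I) =
      N * if (N : ℤ) ∣ a then 1 else 0 := by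
  have hN0 : (N : ℂ) ≠ 0 := by exact_mod_cast hN.ne'
  set z : ℂ := exp (2 * Real.pi * I * a / N) with hz
  have hterm (j : Fin N) : exp (a * theta N (j.val + 1) * I) = z * z ^ j.val := by
    rw [hz, ← pow_succ', ← exp_nat_mul]
    congr 1
    simp only [theta]
    push_cast
    field_simp
  have hzN : z ^ N = 1 := by
    rw [hz, ← exp_nat_mul, exp_eq_one_iff]
    exact ⟨a, by field_simp⟩
  simp_rw [hterm]
  rw [← Finset.mul_sum, Fin.sum_univ_eq_sum_range (fun j => z ^ j) N]
  split_ifs with h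
  · obtain ⟨b, rfl⟩ := h
    have : z = 1 := by
      rw [hz, exp_eq_one_iff]
      exact ⟨b, by push_cast; field_simp⟩
    simp [this]
  · have hz1 : z ≠ 1 := by
      intro h1
      rw [hz, exp_eq_one_iff] at h1
      obtain ⟨b, hb⟩ := h1
      apply h
      refine ⟨b, ?_⟩
      have h2 : (2 * Real.pi * I : ℂ) ≠ 0 := two_pi_I_ne_zero
      have h3 : (2 * Real.pi * I : ℂ) * a = (2 * Real.pi * I) * (N * b) := by
        field_simp at hb
        linear_combination (2 * Real.pi * I : ℂ) * hb
      exact_mod_cast mul_left_cancel₀ h2 h3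
    rw [geom_sum_eq hz1, hzN]
    simp

open Complex in
theorem sum_cos_mul_exp_theta (N : ℕ) (p : ℕ) (n : ℤ) :
    ∑ j : Fin N, (Real.cos (p * theta N (j.val + 1)) : ℂ) * exp (n * theta N (j.val + 1) * I) =
      (∑ j : Fin N, exp ((n + p : ℤ) * theta N (j.val + 1) * I) +
        ∑ j : Fin N, exp ((n - p : ℤ) * theta N (j.val + 1) * I)) / 2 := by
  rw [← Finset.sum_add_distrib, Finset.sum_div]
  refine Finset.sum_congr rfl fun j _ => ?_
  push_cast
  rw [Complex.cos, div_mul_eq_mul_div, add_mul, ← exp_add, ← exp_add]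
  ring_nf

open Complex in
theorem sum_sin_mul_exp_theta (N : ℕ) (p : ℕ) (n : ℤ) :
    ∑ j : Fin N, (Real.sin (p * theta N (j.val + 1)) : ℂ) * exp (n * theta N (j.val + 1) * I) =
      (∑ j : Fin N, exp ((n - p : ℤ) * theta N (j.val + 1) * I) -
        ∑ j : Fin N, exp ((n + p : ℤ) * theta N (j.val + 1) * I)) * I / 2 := by
  rw [← Finset.sum_sub_distrib, Finset.sum_mul, Finset.sum_div]
  refine Finset.sum_congr rfl fun j _ => ?_
  push_cast
  rw [Complex.sin, div_mul_eq_mul_div, mul_right_comm, sub_mul, ← exp_add, ← exp_add]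
  ring_nf

theorem sum_cos_sq_theta {N p : ℕ} (hN : 0 < N) (hp : ¬ (N : ℤ) ∣ p + p) :
    ∑ j : Fin N, Real.cos (p * theta N (j.val + 1)) ^ 2 = N / 2 := by
  have h := congrArg Complex.re (sum_cos_mul_exp_theta N p p)
  rw [sum_exp_theta N hN, sum_exp_theta N hN, if_neg hp, sub_self, if_pos (dvd_zero _),
    mul_zero, mul_one, zero_add, Complex.re_sum] at h
  have hR : ((N : ℂ) / 2).re = N / 2 := by simp
  rw [hR] at h
  rw [← h]
  refine Finset.sum_congr rfl fun j _ => ?_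
  rw [Complex.re_ofReal_mul, sq]
  norm_cast
  rw [Complex.exp_ofReal_mul_I_re]

theorem sum_sin_sq_theta {N p : ℕ} (hN : 0 < N) (hp : ¬ (N : ℤ) ∣ p + p) :
    ∑ j : Fin N, Real.sin (p * theta N (j.val + 1)) ^ 2 = N / 2 := by
  have h := congrArg Complex.im (sum_sin_mul_exp_theta N p p)
  rw [sum_exp_theta N hN, sum_exp_theta N hN, if_neg hp, sub_self, if_pos (dvd_zero _),
    mul_zero, mul_one, sub_zero, Complex.im_sum, mul_div_right_comm] at h
  have hR : ((N : ℂ) / 2 * Complex.I).im = N / 2 := by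
    simp
  rw [hR] at h
  rw [← h]
  refine Finset.sum_congr rfl fun j _ => ?_
  rw [Complex.im_ofReal_mul, sq]
  norm_cast
  rw [Complex.exp_ofReal_mul_I_im]

theorem psi_even (N : ℕ) (κ : ℝ) (p : ℕ) (s θ : ℝ) :
    psi N κ (2 * p) s θ = Real.sqrt ((N : ℝ) / 2) * (s ^ p * Real.sin (p * θ) -
      κ ^ (N - 2 * p) * s ^ (N - p) * Real.sin (((N - p : ℕ) : ℝ) * θ)) := by
  rw [psi, if_neg (by omega), if_pos (by omega), Nat.mul_div_cancel_left p two_pos]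

theorem psi_odd (N : ℕ) (κ : ℝ) {p : ℕ} (hp : 1 ≤ p) (s θ : ℝ) :
    psi N κ (2 * p + 1) s θ = Real.sqrt ((N : ℝ) / 2) * (s ^ p * Real.cos (p * θ) +
      κ ^ (N - 2 * p) * s ^ (N - p) * Real.cos (((N - p : ℕ) : ℝ) * θ)) := by
  rw [psi, if_neg (by omega), if_neg (by omega), show (2 * p + 1) / 2 = p by omega]

theorem sub_mul_theta {N p : ℕ} (hN : 0 < N) (hp : p ≤ N) (j : ℕ) :
    ((N - p : ℕ) : ℝ) * theta N j = j * (2 * Real.pi) - p * theta N j := by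
  have hN0 : (N : ℝ) ≠ 0 := by exact_mod_cast hN.ne'
  rw [theta, Nat.cast_sub hp]
  field_simp

theorem psi_even_theta {N p : ℕ} (hN : 0 < N) (hp : p ≤ N) (κ : ℝ) (j : ℕ) :
    psi N κ (2 * p) 1 (theta N j) =
      Real.sqrt ((N : ℝ) / 2) * (1 + κ ^ (N - 2 * p)) * Real.sin (p * theta N j) := by
  rw [psi_even, sub_mul_theta hN hp, Real.sin_nat_mul_two_pi_sub]
  ring

theorem psi_odd_theta {N p : ℕ} (hp1 : 1 ≤ p) (hp : p ≤ N) (κ : ℝ) (j : ℕ) :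
    psi N κ (2 * p + 1) 1 (theta N j) =
      Real.sqrt ((N : ℝ) / 2) * (1 + κ ^ (N - 2 * p)) * Real.cos (p * theta N j) := by
  rw [psi_odd N κ hp1, sub_mul_theta (hp1.trans hp) hp, Real.cos_nat_mul_two_pi_sub]
  ring

/-- The `k`-th summand of `dsmSum`, with a natural-number index `k`. -/
noncomputable def dsmTerm (N : ℕ) (κ : ℝ) (n : ℤ) (s θ : ℝ) (k : ℕ) : ℂ :=
  ((∑ j : Fin N, psi N κ k 1 (theta N (j.val + 1)) ^ 2 : ℝ) : ℂ)⁻¹ *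
    (∑ j : Fin N, (psi N κ k 1 (theta N (j.val + 1)) : ℂ) *
      Complex.exp (n * theta N (j.val + 1) * Complex.I)) * (psi N κ k s θ : ℂ)

theorem sum_range_two_mul_add_one {A : Type*} [AddCommMonoid A] (f : ℕ → A) (M : ℕ) :
    ∑ k ∈ Finset.range (2 * M + 1), f (k + 1) =
      f 1 + ∑ p ∈ Finset.Icc 1 M, (f (2 * p) + f (2 * p + 1)) := by
  induction M with
  | zero => simp
  | succ M ih =>
    rw [show 2 * (M + 1) + 1 = 2 * M + 1 + 1 + 1 by ring, Finset.sum_range_succ,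
      Finset.sum_range_succ, ih, Finset.sum_Icc_succ_top (by omega)]
    simp only [add_assoc]
    rfl

theorem dsmSum_eq_sum_dsmTerm (M : ℕ) (κ : ℝ) (n : ℤ) (s θ : ℝ) :
    dsmSum (2 * M + 1) κ n s θ = dsmTerm (2 * M + 1) κ n s θ 1 + ∑ p ∈ Finset.Icc 1 M,
      (dsmTerm (2 * M + 1) κ n s θ (2 * p) + dsmTerm (2 * M + 1) κ n s θ (2 * p + 1)) := by
  rw [← sum_range_two_mul_add_one, ← Fin.sum_univ_eq_sum_range
    (fun k => dsmTerm (2 * M + 1) κ n s θ (k + 1))]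
  refine Finset.sum_congr rfl fun k _ => ?_
  simp only [dsmTerm, Matrix.mul_apply, Matrix.transpose_apply, Gmat, sq]

theorem dsmTerm_one {N : ℕ} (hN : 0 < N) (κ : ℝ) (n : ℤ) (s θ : ℝ) :
    dsmTerm N κ n s θ 1 = if (N : ℤ) ∣ n then 1 else 0 := by
  have hN0 : (N : ℂ) ≠ 0 := by exact_mod_cast hN.ne'
  have hsq : ((Real.sqrt N : ℝ) : ℂ) ^ 2 = N := by
    exact_mod_cast congrArg Complex.ofReal (Real.sq_sqrt (Nat.cast_nonneg N))
  simp only [dsmTerm, psi, if_true]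
  rw [← Finset.mul_sum, sum_exp_theta N hN]
  simp only [Finset.sum_const, Finset.card_univ, Fintype.card_fin, nsmul_eq_mul]
  push_cast
  rw [hsq]
  split_ifs
  · field_simp
    exact hsq
  · simp

theorem ofReal_mul_exp_pow (s θ : ℝ) (p : ℕ) :
    ((s : ℂ) * Complex.exp (θ * Complex.I)) ^ p =
      s ^ p * (Real.cos (p * θ) + Real.sin (p * θ) * Complex.I) := by
  rw [mul_pow, ← Complex.exp_nat_mul, ← mul_assoc, Complex.exp_mul_I]
  push_cast
  rfl

theorem conj_ofReal_mul_exp_pow (s θ : ℝ) (p : ℕ) :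
    (starRingEnd ℂ ((s : ℂ) * Complex.exp (θ * Complex.I))) ^ p =
      s ^ p * (Real.cos (p * θ) - Real.sin (p * θ) * Complex.I) := by
  rw [← map_pow, ofReal_mul_exp_pow]
  simp only [map_mul, map_pow, map_add, Complex.conj_ofReal, Complex.conj_I]
  ring

theorem not_dvd_of_abs_lt {N a : ℤ} (ha : a ≠ 0) (h : |a| < N) : ¬ N ∣ a :=
  fun hd => ha (Int.eq_zero_of_abs_lt_dvd hd h)

theorem ofReal_sqrt_half_sq (N : ℕ) : ((Real.sqrt ((N : ℝ) / 2) : ℝ) : ℂ) ^ 2 = N / 2 := by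
  rw [← Complex.ofReal_pow, Real.sq_sqrt (by positivity)]
  push_cast
  rfl

theorem dsmTerm_even {N p : ℕ} (hp1 : 1 ≤ p) (hp : 2 * p < N) {κ : ℝ} (hκ : 0 < κ)
    (n : ℤ) (s θ : ℝ) :
    dsmTerm N κ n s θ (2 * p) = ((1 + κ ^ (N - 2 * p) : ℝ) : ℂ)⁻¹ *
      ((if (N : ℤ) ∣ n - p then 1 else 0) - (if (N : ℤ) ∣ n + p then 1 else 0)) * Complex.I *
      (s ^ p * Real.sin (p * θ) - κ ^ (N - 2 * p) * s ^ (N - p) *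
        Real.sin (((N - p : ℕ) : ℝ) * θ) : ℝ) := by
  have hN : 0 < N := by omega
  have hdvd : ¬ (N : ℤ) ∣ p + p := not_dvd_of_abs_lt (by omega) (by rw [abs_lt]; omega)
  have hN0 : (N : ℂ) ≠ 0 := by exact_mod_cast hN.ne'
  have hc0 : ((1 + κ ^ (N - 2 * p) : ℝ) : ℂ) ≠ 0 := by
    exact_mod_cast (by positivity : (1 + κ ^ (N - 2 * p) : ℝ) ≠ 0)
  have hr := ofReal_sqrt_half_sq N
  rw [dsmTerm]
  simp only [psi_even_theta hN (by omega : p ≤ N), mul_pow, ← Finset.mul_sum,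
    sum_sin_sq_theta hN hdvd, Complex.ofReal_mul (_ * _), mul_assoc (Complex.ofReal (_ * _)),
    sum_sin_mul_exp_theta, sum_exp_theta N hN, psi_even]
  rw [Complex.ofReal_mul (Real.sqrt _), Complex.ofReal_mul (Real.sqrt _)]
  generalize (s ^ p * Real.sin (p * θ) - κ ^ (N - 2 * p) * s ^ (N - p) *
        Real.sin (((N - p : ℕ) : ℝ) * θ) : ℝ) = S
  generalize 1 + κ ^ (N - 2 * p) = d at hc0 ⊢
  simp only [Complex.ofReal_mul, Complex.ofReal_pow, Complex.ofReal_div, Complex.ofReal_natCast,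
    Complex.ofReal_ofNat, hr]
  generalize ((Real.sqrt ((N : ℝ) / 2) : ℝ) : ℂ) = r at hr ⊢
  generalize (if (N : ℤ) ∣ n - p then 1 else 0 : ℂ) = e₁
  generalize (if (N : ℤ) ∣ n + p then 1 else 0 : ℂ) = e₂
  field_simp
  linear_combination 2 * S * (e₁ - e₂) * hr

theorem dsmTerm_odd {N p : ℕ} (hp1 : 1 ≤ p) (hp : 2 * p < N) {κ : ℝ} (hκ : 0 < κ)
    (n : ℤ) (s θ : ℝ) :
    dsmTerm N κ n s θ (2 * p + 1) = ((1 + κ ^ (N - 2 * p) : ℝ) : ℂ)⁻¹ *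
      ((if (N : ℤ) ∣ n + p then 1 else 0) + (if (N : ℤ) ∣ n - p then 1 else 0)) *
      (s ^ p * Real.cos (p * θ) + κ ^ (N - 2 * p) * s ^ (N - p) *
        Real.cos (((N - p : ℕ) : ℝ) * θ) : ℝ) := by
  have hN : 0 < N := by omega
  have hdvd : ¬ (N : ℤ) ∣ p + p := not_dvd_of_abs_lt (by omega) (by rw [abs_lt]; omega)
  have hN0 : (N : ℂ) ≠ 0 := by exact_mod_cast hN.ne'
  have hc0 : ((1 + κ ^ (N - 2 * p) : ℝ) : ℂ) ≠ 0 := by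
    exact_mod_cast (by positivity : (1 + κ ^ (N - 2 * p) : ℝ) ≠ 0)
  have hr := ofReal_sqrt_half_sq N
  rw [dsmTerm]
  simp only [psi_odd_theta hp1 (by omega : p ≤ N), mul_pow, ← Finset.mul_sum,
    sum_cos_sq_theta hN hdvd, Complex.ofReal_mul (_ * _), mul_assoc (Complex.ofReal (_ * _)),
    sum_cos_mul_exp_theta, sum_exp_theta N hN, psi_odd N κ hp1]
  rw [Complex.ofReal_mul (Real.sqrt _), Complex.ofReal_mul (Real.sqrt _)]
  generalize (s ^ p * Real.cos (p * θ) + κ ^ (N - 2 * p) * s ^ (N - p) *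
        Real.cos (((N - p : ℕ) : ℝ) * θ) : ℝ) = S
  generalize 1 + κ ^ (N - 2 * p) = d at hc0 ⊢
  simp only [Complex.ofReal_mul, Complex.ofReal_pow, Complex.ofReal_div, Complex.ofReal_natCast,
    Complex.ofReal_ofNat, hr]
  generalize ((Real.sqrt ((N : ℝ) / 2) : ℝ) : ℂ) = r at hr ⊢
  generalize (if (N : ℤ) ∣ n - p then 1 else 0 : ℂ) = e₁
  generalize (if (N : ℤ) ∣ n + p then 1 else 0 : ℂ) = e₂
  field_simp
  linear_combination 2 * S * (e₁ + e₂) * hr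

theorem dsmTerm_even_add_odd {N p : ℕ} (hp1 : 1 ≤ p) (hp : 2 * p < N) {κ : ℝ} (hκ : 0 < κ)
    (n : ℤ) (s θ : ℝ) :
    dsmTerm N κ n s θ (2 * p) + dsmTerm N κ n s θ (2 * p + 1) =
      ((1 + κ ^ (N - 2 * p) : ℝ) : ℂ)⁻¹ *
        ((if (N : ℤ) ∣ n - p then 1 else 0) *
          (((s : ℂ) * Complex.exp (θ * Complex.I)) ^ p + ((κ ^ (N - 2 * p) : ℝ) : ℂ) *
            (starRingEnd ℂ ((s : ℂ) * Complex.exp (θ * Complex.I))) ^ (N - p)) +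
        (if (N : ℤ) ∣ n + p then 1 else 0) *
          ((starRingEnd ℂ ((s : ℂ) * Complex.exp (θ * Complex.I))) ^ p +
            ((κ ^ (N - 2 * p) : ℝ) : ℂ) *
              ((s : ℂ) * Complex.exp (θ * Complex.I)) ^ (N - p))) := by
  rw [dsmTerm_even hp1 hp hκ, dsmTerm_odd hp1 hp hκ]
  simp only [ofReal_mul_exp_pow, conj_ofReal_mul_exp_pow, Complex.ofReal_add, Complex.ofReal_sub,
    Complex.ofReal_mul, Complex.ofReal_pow]
  ring

theorem dsmSum_eq_phi (N : ℕ) (hNodd : Odd N) (hN3 : 3 ≤ N)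
    (κ : ℝ) (hκ : κ ∈ Set.Ioo (0 : ℝ) 1) (n : ℤ) (s θ : ℝ) :
    ((N : ℤ) ∣ n → dsmSum N κ n s θ = 1) ∧
    (∀ m : ℕ, 1 ≤ m → m ≤ (N - 1) / 2 →
      ((N : ℤ) ∣ (n - m) →
        dsmSum N κ n s θ =
          ((1 + κ ^ (N - 2 * m) : ℝ) : ℂ)⁻¹ *
            (((s : ℂ) * Complex.exp (θ * Complex.I)) ^ m +
              ((κ ^ (N - 2 * m) : ℝ) : ℂ) *
                (starRingEnd ℂ ((s : ℂ) * Complex.exp (θ * Complex.I))) ^ (N - m))) ∧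
      ((N : ℤ) ∣ (n + m) →
        dsmSum N κ n s θ =
          ((1 + κ ^ (N - 2 * m) : ℝ) : ℂ)⁻¹ *
            ((starRingEnd ℂ ((s : ℂ) * Complex.exp (θ * Complex.I))) ^ m +
              ((κ ^ (N - 2 * m) : ℝ) : ℂ) *
                ((s : ℂ) * Complex.exp (θ * Complex.I)) ^ (N - m)))) := by
  obtain ⟨M, rfl⟩ := hNodd
  have hterm := fun p (hp : p ∈ Finset.Icc 1 M) => dsmTerm_even_add_odd (N := 2 * M + 1)
    (Finset.mem_Icc.1 hp).1 (by have := (Finset.mem_Icc.1 hp).2; omega) hκ.1 n s θ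
  have hdvd {a : ℤ} (h0 : a ≠ 0) (h1 : -(2 * M + 1 : ℤ) < a) (h2 : a < 2 * M + 1) :
      ¬ ((2 * M + 1 : ℕ) : ℤ) ∣ a :=
    not_dvd_of_abs_lt h0 (by rw [abs_lt]; omega)
  rw [dsmSum_eq_sum_dsmTerm, dsmTerm_one (by omega), Finset.sum_congr rfl hterm]
  refine ⟨fun hn => ?_, fun m hm1 hm => ⟨fun hn => ?_, fun hn => ?_⟩⟩
  · rw [if_pos hn, add_eq_left]
    refine Finset.sum_eq_zero fun p hp => ?_
    obtain ⟨hp1, hpM⟩ := Finset.mem_Icc.1 hp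
    rw [if_neg, if_neg, zero_mul, zero_mul, add_zero, mul_zero]
    · exact fun h => hdvd (by omega) (by omega) (by omega) (dvd_sub h hn)
    · exact fun h => hdvd (by omega) (by omega) (by omega) (dvd_sub h hn)
  · rw [if_neg, zero_add, Finset.sum_eq_single_of_mem m (Finset.mem_Icc.2 ⟨hm1, by omega⟩),
      if_pos hn, if_neg, one_mul, zero_mul, add_zero]
    · exact fun h => hdvd (by omega) (by omega) (by omega) (dvd_sub h hn)
    · intro p hp hpm
      obtain ⟨hp1, hpM⟩ := Finset.mem_Icc.1 hp
      rw [if_neg, if_neg, zero_mul, zero_mul, add_zero, mul_zero]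
      · exact fun h => hdvd (by omega) (by omega) (by omega) (dvd_sub h hn)
      · exact fun h => hdvd (by omega) (by omega) (by omega) (dvd_sub h hn)
    · exact fun h => hdvd (by omega) (by omega) (by omega) (dvd_sub h hn)
  · rw [if_neg, zero_add, Finset.sum_eq_single_of_mem m (Finset.mem_Icc.2 ⟨hm1, by omega⟩),
      if_neg, if_pos hn, one_mul, zero_mul, zero_add]
    · exact fun h => hdvd (by omega) (by omega) (by omega) (dvd_sub h hn)
    · intro p hp hpm
      obtain ⟨hp1, hpM⟩ := Finset.mem_Icc.1 hp
      rw [if_neg, if_neg, zero_mul, zero_mul, add_zero, mul_zero]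
      · exact fun h => hdvd (by omega) (by omega) (by omega) (dvd_sub h hn)
      · exact fun h => hdvd (by omega) (by omega) (by omega) (dvd_sub h hn)
    · exact fun h => hdvd (by omega) (by omega) (by omega) (dvd_sub h hn)
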